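/- For every positive integers r and D there are only finitely many isometry classes of lattices of rank r and discriminant of absolute value D. -/

import Mathlib

set_option linter.unusedSectionVars false
set_option linter.unusedSimpArgs false
namespace LatFin
open Matrix

variable {ι κ : Type} [Fintype ι] [DecidableEq ι] [Fintype κ] [DecidableEq κ]

/-- Integral equivalence of Gram matrices. -/
def Eqv (A B : Matrix ι ι ℤ) : Prop :=
  ∃ P : Matrix ι ι ℤ, IsUnit P.det ∧ P.transpose * A * P = B

/-- The quadratic form of a Gram matrix. -/
def qf (A : Matrix ι ι ℤ) (x : ι → ℤ) : ℤ := x ⬝ᵥ (A *ᵥ x)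

/-- Anisotropic forms. -/
def Aniso (A : Matrix ι ι ℤ) : Prop := ∀ x, qf A x = 0 → x = 0

theorem Eqv.refl (A : Matrix ι ι ℤ) : Eqv A A := ⟨1, by simp, by simp⟩

theorem Eqv.trans {A B C : Matrix ι ι ℤ} (h : Eqv A B) (h' : Eqv B C) : Eqv A C := by
  obtain ⟨P, hP, rfl⟩ := h
  obtain ⟨Q, hQ, rfl⟩ := h'
  exact ⟨P * Q, by rw [det_mul]; exact hP.mul hQ, by simp [Matrix.transpose_mul, Matrix.mul_assoc]⟩

theorem Eqv.symm_mat {A B : Matrix ι ι ℤ} (h : Eqv A B) (hA : A.IsSymm) : B.IsSymm := by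
  obtain ⟨P, hP, rfl⟩ := h
  unfold Matrix.IsSymm at *
  simp [Matrix.transpose_mul, Matrix.mul_assoc, hA]

theorem Eqv.det_eq {A B : Matrix ι ι ℤ} (h : Eqv A B) : B.det = A.det := by
  obtain ⟨P, hP, rfl⟩ := h
  rw [det_mul, det_mul, det_transpose]
  rcases Int.isUnit_iff.1 hP with h | h <;> rw [h] <;> ring

theorem qf_congr (A P : Matrix ι ι ℤ) (x : ι → ℤ) : qf (Pᵀ * A * P) x = qf A (P *ᵥ x) := by
  unfold qf
  rw [← mulVec_mulVec, ← mulVec_mulVec, dotProduct_mulVec, vecMul_transpose]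

theorem mulVec_ne {P : Matrix ι ι ℤ} (hP : IsUnit P.det) {x : ι → ℤ} (h : P *ᵥ x = 0) : x = 0 := by
  have : P⁻¹ *ᵥ (P *ᵥ x) = x := by rw [mulVec_mulVec, nonsing_inv_mul _ hP, one_mulVec]
  rw [← this, h, mulVec_zero]

theorem Eqv.aniso {A B : Matrix ι ι ℤ} (h : Eqv A B) (hA : Aniso A) : Aniso B := by
  obtain ⟨P, hP, rfl⟩ := h
  intro x hx
  rw [qf_congr] at hx
  exact mulVec_ne hP (hA _ hx)

theorem qf_single (A : Matrix ι ι ℤ) (i : ι) (d : ℤ) : qf A (Pi.single i d) = d ^ 2 * A i i := by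
  simp [qf]; ring

/-- The Euclidean algorithm. -/
theorem euclid (i0 : ι) (v : ι → ℤ) : ∃ P : Matrix ι ι ℤ, IsUnit P.det ∧
    ∃ d : ℤ, P *ᵥ v = Pi.single i0 d := by
  induction hN : ∑ i, (v i).natAbs using Nat.strong_induction_on generalizing v with
  | _ N ih =>
  by_cases h : ∃ i j, i ≠ j ∧ v j ≠ 0 ∧ (v j).natAbs ≤ (v i).natAbs
  · obtain ⟨i, j, hij, hj, hle⟩ := h
    obtain ⟨c, hc⟩ : ∃ c : ℤ, (v i + c * v j).natAbs < (v i).natAbs := by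
      by_cases hs : 0 < v i * v j
      · refine ⟨-1, ?_⟩
        rcases pos_and_pos_or_neg_and_neg_of_mul_pos hs with h | h <;> omega
      · refine ⟨1, ?_⟩
        have : v i ≠ 0 := by omega
        have hs' : v i * v j < 0 := lt_of_le_of_ne (not_lt.1 hs) (mul_ne_zero this hj)
        rcases mul_neg_iff.1 hs' with h | h <;> omega
    have hT : transvection i j c *ᵥ v = Function.update v i (v i + c * v j) := by
      ext l
      rw [transvection, add_mulVec, one_mulVec]
      by_cases hl : l = i
      · subst hl; simp [mulVec, dotProduct, single_apply]
      · simp [mulVec, dotProduct, single_apply, hl, Ne.symm hl]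
    obtain ⟨P, hP, d, hd⟩ := ih (∑ l, (Function.update v i (v i + c * v j) l).natAbs) (by
      rw [← hN]
      apply Finset.sum_lt_sum
      · intro l _
        by_cases hl : l = i
        · subst hl; simpa using hc.le
        · simp [hl]
      · exact ⟨i, by simp, by simpa using hc⟩) _ rfl
    refine ⟨P * transvection i j c, ?_, d, ?_⟩
    · rw [det_mul, det_transvection_of_ne _ _ hij]; simpa using hP
    · rw [← mulVec_mulVec, hT, hd]
  · push Not at h
    by_cases hv : v = 0
    · exact ⟨1, by simp, 0, by simp [hv]⟩
    · obtain ⟨i, hi⟩ := Function.ne_iff.1 hv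
      have hz : ∀ j, j ≠ i → v j = 0 := by
        intro j hji
        by_contra hj
        have h1 := h i j hji.symm hj
        have h2 := h j i hji hi
        omega
      refine ⟨(Equiv.swap i0 i).permMatrix ℤ, ?_, v i, ?_⟩
      · rw [det_permutation]; exact Units.isUnit _
      · ext l
        rw [permMatrix_mulVec]
        by_cases hl : l = i0
        · subst hl; simp
        · simp only [Function.comp, Pi.single_apply, hl, if_false]
          apply hz
          intro hh
          apply hl
          rw [Equiv.swap_apply_eq_iff] at hh
          simpa using hh

theorem inv_unit {P : Matrix ι ι ℤ} (hP : IsUnit P.det) : IsUnit (P⁻¹).det := by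
  rw [det_nonsing_inv]; simpa using hP

/-- Any value at a nonzero vector is a square times a diagonal entry of an equivalent form. -/
theorem minval (i0 : ι) (A : Matrix ι ι ℤ) (x : ι → ℤ) (hx : x ≠ 0) :
    ∃ B, Eqv A B ∧ ∃ d : ℤ, d ≠ 0 ∧ qf A x = d ^ 2 * B i0 i0 := by
  obtain ⟨P, hP, d, hd⟩ := euclid i0 x
  refine ⟨(P⁻¹)ᵀ * A * P⁻¹, ⟨P⁻¹, inv_unit hP, rfl⟩, d, ?_, ?_⟩
  · rintro rfl
    exact hx (mulVec_ne hP (by simpa using hd))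
  · rw [← qf_single, ← hd, qf_congr, mulVec_mulVec, nonsing_inv_mul _ hP, one_mulVec]

theorem near (x a : ℤ) : ∃ k : ℤ, 2 * |x + a * k| ≤ |a| ∨ a = 0 := by
  by_cases ha : a = 0
  · exact ⟨0, Or.inr ha⟩
  have h1 := Int.emod_nonneg x ha
  have h2 := Int.emod_lt_abs x ha
  have h3 := Int.emod_add_mul_ediv x a
  by_cases h : 2 * (x % a) ≤ |a|
  · refine ⟨-(x / a), Or.inl ?_⟩
    have : x + a * -(x / a) = x % a := by linarith
    rw [this, abs_of_nonneg h1]; exact h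
  · refine ⟨-(x / a) - a.sign, Or.inl ?_⟩
    have h4 : a * a.sign = |a| := Int.mul_sign_self a |>.trans (by simp)
    have : x + a * (-(x / a) - a.sign) = x % a - |a| := by linarith
    rw [this, abs_of_nonpos (by linarith)]; linarith

/-- The Schur complement multiplied by the corner. -/
def Gm (A : Matrix (Unit ⊕ κ) (Unit ⊕ κ) ℤ) : Matrix κ κ ℤ :=
  Matrix.of fun i j => A (.inl ()) (.inl ()) * A (.inr i) (.inr j) -
    A (.inr i) (.inl ()) * A (.inl ()) (.inr j)

theorem Gm_symm {A : Matrix (Unit ⊕ κ) (Unit ⊕ κ) ℤ} (hA : A.IsSymm) : (Gm A).IsSymm := by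
  ext i j
  simp only [Gm, transpose_apply, of_apply, hA.apply (.inr i) (.inr j)]
  rw [← hA.apply (.inl ()) (.inr i), ← hA.apply (.inl ()) (.inr j)]
  ring

theorem Gm_det (A : Matrix (Unit ⊕ κ) (Unit ⊕ κ) ℤ) :
    A (.inl ()) (.inl ()) ^ Fintype.card κ * A.det = A (.inl ()) (.inl ()) * (Gm A).det := by
  set a := A (.inl ()) (.inl ()) with ha
  have h : fromBlocks (1 : Matrix Unit Unit ℤ) 0 (Matrix.of fun i _ => - A (.inr i) (.inl ()))
      (Matrix.diagonal fun _ : κ => a) * A =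
      fromBlocks (Matrix.of fun _ _ => a) (Matrix.of fun _ j => A (.inl ()) (.inr j)) 0 (Gm A) := by
    ext i j
    rcases i with i | i <;> rcases j with j | j <;>
      simp [Matrix.mul_apply, Matrix.diagonal_apply, Gm, ← ha] <;> ring
  have := congrArg Matrix.det h
  rw [det_mul, det_fromBlocks_zero₁₂, det_fromBlocks_zero₂₁] at this
  simpa using this

theorem Gm_qf {A : Matrix (Unit ⊕ κ) (Unit ⊕ κ) ℤ} (hA : A.IsSymm) (t : ℤ) (x : κ → ℤ) :
    A (.inl ()) (.inl ()) * qf A (Sum.elim (fun _ => t) x) =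
    (A (.inl ()) (.inl ()) * t + ∑ i, A (.inl ()) (.inr i) * x i) ^ 2 + qf (Gm A) x := by
  have hs : ∀ i, A (.inr i) (.inl ()) = A (.inl ()) (.inr i) := fun i => hA.apply _ _
  set S := ∑ i, A (.inl ()) (.inr i) * x i with hS
  have h1 : ∑ i, x i * A (.inl ()) (.inr i) = S := by simp [hS, mul_comm]
  have h2 : qf (Gm A) x = A (.inl ()) (.inl ()) * qf (A.toBlocks₂₂) x - S ^ 2 := by
    rw [sq]
    nth_rewrite 1 [← h1]
    rw [hS, Finset.sum_mul]
    simp only [qf, dotProduct, mulVec, Gm, of_apply, toBlocks₂₂, hs, Finset.mul_sum]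
    rw [← Finset.sum_sub_distrib]
    refine Finset.sum_congr rfl fun i _ => ?_
    rw [← Finset.sum_sub_distrib]
    refine Finset.sum_congr rfl fun j _ => ?_
    ring
  have h3 : qf A (Sum.elim (fun _ => t) x) =
      A (.inl ()) (.inl ()) * t ^ 2 + 2 * t * S + qf (A.toBlocks₂₂) x := by
    simp only [qf, dotProduct, mulVec, Fintype.sum_sum_type, Sum.elim_inl, Sum.elim_inr, hs,
      toBlocks₂₂, of_apply, mul_add, Finset.sum_add_distrib, ← hS]
    simp only [Finset.univ_unique, Finset.sum_singleton]
    have : ∑ i, x i * (A (.inl ()) (.inr i) * t) = S * t := by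
      rw [← h1, Finset.sum_mul]; exact Finset.sum_congr rfl fun i _ => by ring
    rw [this]
    change t * (A (.inl ()) (.inl ()) * t) + _ + _ = _
    ring
  rw [h3, h2]; ring

/-- Change of basis in the second block. -/
theorem stepQ (A : Matrix (Unit ⊕ κ) (Unit ⊕ κ) ℤ) (Q : Matrix κ κ ℤ) (hQ : IsUnit Q.det) :
    ∃ B, Eqv A B ∧ B (.inl ()) (.inl ()) = A (.inl ()) (.inl ()) ∧
      (∀ j, B (.inl ()) (.inr j) = ((fun i => A (.inl ()) (.inr i)) ᵥ* Q) j) ∧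
      B.toBlocks₂₂ = Qᵀ * A.toBlocks₂₂ * Q ∧
      Gm B = Qᵀ * Gm A * Q := by
  have key : (fromBlocks (1 : Matrix Unit Unit ℤ) 0 0 Q)ᵀ * A * fromBlocks 1 0 0 Q =
      fromBlocks A.toBlocks₁₁ (A.toBlocks₁₂ * Q) (Qᵀ * A.toBlocks₂₁) (Qᵀ * A.toBlocks₂₂ * Q) := by
    conv_lhs => rw [← fromBlocks_toBlocks A]
    simp [fromBlocks_transpose, fromBlocks_multiply]
  have h22 : ∀ M : Matrix κ κ ℤ, ∀ i j, (Qᵀ * M * Q) i j = ∑ l, ∑ k, Q k i * M k l * Q l j := by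
    intro M i j
    simp [Matrix.mul_apply, Finset.sum_mul]
  refine ⟨_, ⟨fromBlocks 1 0 0 Q, by rw [det_fromBlocks_zero₂₁]; simpa using hQ, rfl⟩, ?_, ?_, ?_, ?_⟩
  · rw [key]; rfl
  · intro j; rw [key]; rfl
  · rw [key]; simp
  · rw [key]
    ext i j
    rw [h22]
    simp only [Gm, of_apply, fromBlocks_apply₁₁, fromBlocks_apply₁₂, fromBlocks_apply₂₁,
      fromBlocks_apply₂₂, h22]
    simp only [Matrix.mul_apply, transpose_apply, toBlocks₁₁, toBlocks₁₂, toBlocks₂₁, toBlocks₂₂,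
      of_apply]
    rw [Finset.mul_sum, Finset.mul_sum, ← Finset.sum_sub_distrib]
    refine Finset.sum_congr rfl fun l _ => ?_
    rw [Finset.mul_sum, Finset.sum_mul, ← Finset.sum_sub_distrib]
    refine Finset.sum_congr rfl fun k _ => ?_
    ring

/-- Shear by multiples of the first basis vector. -/
theorem stepK {A : Matrix (Unit ⊕ κ) (Unit ⊕ κ) ℤ} (hA : A.IsSymm) (k : κ → ℤ) :
    ∃ B, Eqv A B ∧ B (.inl ()) (.inl ()) = A (.inl ()) (.inl ()) ∧
      (∀ j, B (.inl ()) (.inr j) = A (.inl ()) (.inr j) + A (.inl ()) (.inl ()) * k j) ∧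
      (∀ i j, B (.inr i) (.inr j) = A (.inr i) (.inr j) + k i * A (.inl ()) (.inr j) +
        A (.inl ()) (.inr i) * k j + A (.inl ()) (.inl ()) * k i * k j) ∧
      Gm B = Gm A := by
  have hs : ∀ i, A (.inr i) (.inl ()) = A (.inl ()) (.inr i) := fun i => hA.apply _ _
  set P := fromBlocks (1 : Matrix Unit Unit ℤ) (Matrix.of fun _ j => k j) 0 (1 : Matrix κ κ ℤ)
  have hE : Eqv A (Pᵀ * A * P) := ⟨P, by simp [P], rfl⟩
  have h00 : (Pᵀ * A * P) (.inl ()) (.inl ()) = A (.inl ()) (.inl ()) := by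
    simp [P, Matrix.mul_apply, Matrix.one_apply]
  have h01 : ∀ j, (Pᵀ * A * P) (.inl ()) (.inr j) =
      A (.inl ()) (.inr j) + A (.inl ()) (.inl ()) * k j := by
    intro j; simp [P, Matrix.mul_apply, Matrix.one_apply]; ring
  have h11 : ∀ i j, (Pᵀ * A * P) (.inr i) (.inr j) =
      A (.inr i) (.inr j) + k i * A (.inl ()) (.inr j) +
        A (.inl ()) (.inr i) * k j + A (.inl ()) (.inl ()) * k i * k j := by
    intro i j; simp [P, Matrix.mul_apply, Matrix.one_apply, hs]; ring
  have hB := hE.symm_mat hA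
  refine ⟨_, hE, h00, h01, h11, ?_⟩
  ext i j
  have h10 := hB.apply (.inl ()) (.inr i)
  simp only [Gm, of_apply, h10, h00, h01, h11, hs]
  ring

/-- The Hermite bound for anisotropic forms. -/
def Herm (ι : Type) [Fintype ι] [DecidableEq ι] : Prop :=
  ∃ C : ℤ, 0 ≤ C ∧ ∀ A : Matrix ι ι ℤ, A.IsSymm → Aniso A →
    ∃ x, x ≠ 0 ∧ |qf A x| ^ Fintype.card ι ≤ C * |A.det|

/-- Bounded representatives. -/
def Bdd (ι : Type) [Fintype ι] [DecidableEq ι] : Prop :=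
  ∀ D : ℤ, ∃ K : ℤ, ∀ A : Matrix ι ι ℤ, A.IsSymm → A.det ≠ 0 → |A.det| ≤ D →
    ∃ B, Eqv A B ∧ ∀ i j, |B i j| ≤ K

theorem qf_submatrix (e : ι ≃ κ) (A : Matrix κ κ ℤ) (x : κ → ℤ) :
    qf (A.submatrix e e) (x ∘ e) = qf A x := by
  simp only [qf, dotProduct, mulVec, submatrix_apply, Function.comp]
  rw [← e.sum_comp]
  refine Finset.sum_congr rfl fun i _ => ?_
  rw [← e.sum_comp (fun j => A (e i) j * x j)]

theorem Herm.transfer (e : ι ≃ κ) (h : Herm ι) : Herm κ := by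
  obtain ⟨C, hC, h⟩ := h
  refine ⟨C, hC, fun A hA han => ?_⟩
  obtain ⟨x, hx, hb⟩ := h (A.submatrix e e) (hA.submatrix e) (by
    intro x hx
    have := qf_submatrix e A (x ∘ e.symm)
    rw [Function.comp_assoc, e.symm_comp_self, Function.comp_id, hx] at this
    have h0 := han _ this.symm
    ext i
    simpa using congrFun h0 (e i))
  refine ⟨x ∘ e.symm, ?_, ?_⟩
  · intro h0
    apply hx
    ext i
    simpa using congrFun h0 (e i)
  · have := qf_submatrix e A (x ∘ e.symm)
    rw [Function.comp_assoc, e.symm_comp_self, Function.comp_id] at this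
    rwa [← this, ← Fintype.card_congr e, ← det_submatrix_equiv_self e A]

theorem Bdd.transfer (e : ι ≃ κ) (h : Bdd ι) : Bdd κ := by
  intro D
  obtain ⟨K, h⟩ := h D
  refine ⟨K, fun A hA hd hD => ?_⟩
  obtain ⟨B, ⟨P, hP, rfl⟩, hB⟩ := h (A.submatrix e e) (hA.submatrix e)
    (by rwa [det_submatrix_equiv_self]) (by rwa [det_submatrix_equiv_self])
  have hE : (P.submatrix e.symm e.symm)ᵀ * A * P.submatrix e.symm e.symm =
      (Pᵀ * A.submatrix e e * P).submatrix e.symm e.symm := by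
    rw [← submatrix_mul_equiv _ _ _ e.symm, ← submatrix_mul_equiv _ _ _ e.symm]
    simp
  refine ⟨_, ⟨P.submatrix e.symm e.symm, by rwa [det_submatrix_equiv_self], rfl⟩, fun i j => ?_⟩
  rw [hE]
  exact hB _ _

theorem Aniso.corner {A : Matrix ι ι ℤ} (h : Aniso A) (i : ι) : A i i ≠ 0 := by
  intro h0
  have := h (Pi.single i 1) (by rw [qf_single, h0]; simp)
  simpa using congrFun this i

/-- Every anisotropic form is equivalent to one whose corner is minimal. -/
theorem exists_min (i0 : ι) (A : Matrix ι ι ℤ) :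
    ∃ B, Eqv A B ∧ ∀ x, x ≠ 0 → qf B x ≠ 0 → |B i0 i0| ≤ |qf B x| ∨ B i0 i0 = 0 := by
  obtain ⟨B, hB, hmin⟩ := WellFounded.has_min (measure fun B : Matrix ι ι ℤ => (B i0 i0).natAbs).wf
    {B | Eqv A B} ⟨A, Eqv.refl A⟩
  refine ⟨B, hB, fun x hx _ => Or.inl ?_⟩
  obtain ⟨B', hB', d, hd, he⟩ := minval i0 B x hx
  have h1 := hmin B' (hB.trans hB')
  simp only [measure, invImage, InvImage, WellFoundedRelation.rel, Nat.lt_eq, not_lt] at h1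
  have h2 : |B i0 i0| ≤ |B' i0 i0| := by
    rw [Int.abs_eq_natAbs, Int.abs_eq_natAbs]; exact_mod_cast h1
  rw [he, abs_mul]
  have h3 : 1 ≤ |d ^ 2| := Int.one_le_abs (pow_ne_zero 2 hd)
  nlinarith [abs_nonneg (B' i0 i0)]

theorem Gm_aniso {A : Matrix (Unit ⊕ κ) (Unit ⊕ κ) ℤ} (hA : A.IsSymm) (h : Aniso A) :
    Aniso (Gm A) := by
  intro x hx
  set a := A (.inl ()) (.inl ()) with ha
  have ha0 : a ≠ 0 := h.corner _
  have h1 := Gm_qf hA (-∑ i, A (.inl ()) (.inr i) * x i) (a • x)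
  have h2 : qf (Gm A) (a • x) = 0 := by
    have : qf (Gm A) (a • x) = a * a * qf (Gm A) x := by
      rw [qf, mulVec_smul, smul_dotProduct, dotProduct_smul, smul_eq_mul, smul_eq_mul, ← mul_assoc]; rfl
    rw [this, hx, mul_zero]
  have h3 : ∑ i, A (.inl ()) (.inr i) * (a • x) i = a * ∑ i, A (.inl ()) (.inr i) * x i := by
    rw [Finset.mul_sum]
    refine Finset.sum_congr rfl fun i _ => ?_
    simp; ring
  rw [h2, h3, ← ha] at h1
  have h4 := h _ ((mul_eq_zero.1 (h1.trans (by ring))).resolve_left ha0)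
  ext i
  have := congrFun h4 (.inr i)
  simpa [ha0] using this

theorem herm_step {n : ℕ} (hn : Fintype.card κ = n + 1) (h : Herm κ) : Herm (Unit ⊕ κ) := by
  obtain ⟨C, hC, h⟩ := h
  refine ⟨2 ^ (n + 1) * C, by positivity, fun A₀ hA₀ han₀ => ?_⟩
  obtain ⟨A, hE, hmin⟩ := exists_min (.inl ()) A₀
  have hA := hE.symm_mat hA₀
  have han := hE.aniso han₀
  set a := A (.inl ()) (.inl ()) with ha
  have ha0 : a ≠ 0 := han.corner _
  obtain ⟨x, hx, hb⟩ := h (Gm A) (Gm_symm hA) (Gm_aniso hA han)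
  obtain ⟨k, hk⟩ := near (∑ i, A (.inl ()) (.inr i) * x i) a
  replace hk := hk.resolve_right ha0
  have hq := Gm_qf hA k x
  rw [← ha] at hq
  set y : Unit ⊕ κ → ℤ := Sum.elim (fun _ => k) x with hy
  have hy0 : y ≠ 0 := by
    intro h0
    apply hx
    ext i
    exact congrFun h0 (.inr i)
  have hm := (hmin y hy0 (fun h0 => hy0 (han _ h0))).resolve_right ha0
  set t := a * k + ∑ i, A (.inl ()) (.inr i) * x i with ht
  have hk' : 2 * |t| ≤ |a| := by rw [ht, add_comm]; exact hk
  have hg : |a| ^ 2 ≤ 2 * |qf (Gm A) x| := by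
    have h1 : |a| * |qf A y| ≤ |t| ^ 2 + |qf (Gm A) x| := by
      rw [← abs_mul, hq]
      refine (abs_add_le _ _).trans ?_
      rw [abs_pow]
    nlinarith [abs_nonneg t, abs_nonneg a]
  have hdet := congrArg abs (Gm_det A)
  rw [abs_mul, abs_mul, abs_pow, ← ha, hn] at hdet
  have hapos : 0 < |a| := abs_pos.2 ha0
  have hdet' : |(Gm A).det| = |a| ^ n * |A.det| := by
    apply mul_left_cancel₀ hapos.ne'
    rw [← hdet]; ring
  rw [hn, hdet'] at hb
  have hfin : |a| ^ (n + 2) ≤ 2 ^ (n + 1) * C * |A.det| := by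
    have h1 : (|a| ^ 2) ^ (n + 1) ≤ (2 * |qf (Gm A) x|) ^ (n + 1) := by gcongr
    rw [mul_pow] at h1
    have h2 : |a| ^ n * |a| ^ (n + 2) ≤ |a| ^ n * (2 ^ (n + 1) * C * |A.det|) := by
      calc |a| ^ n * |a| ^ (n + 2) = (|a| ^ 2) ^ (n + 1) := by ring
        _ ≤ _ := h1
        _ ≤ 2 ^ (n + 1) * (C * (|a| ^ n * |A.det|)) := by gcongr
        _ = _ := by ring
    exact le_of_mul_le_mul_left h2 (by positivity)
  obtain ⟨P, hP, rfl⟩ := hE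
  refine ⟨P *ᵥ Pi.single (.inl ()) 1, ?_, ?_⟩
  · intro h0
    simpa using congrFun (mulVec_ne hP h0) (.inl ())
  · rw [← qf_congr, qf_single, one_pow, one_mul, ← ha, Fintype.card_sum, hn, Fintype.card_unit,
      add_comm 1, ← (Eqv.det_eq ⟨P, hP, rfl⟩ : (Pᵀ * A₀ * P).det = A₀.det)]
    exact hfin

theorem herm_fin (n : ℕ) : Herm (Fin (n + 1)) := by
  induction n with
  | zero =>
    refine ⟨1, by simp, fun A _ _ => ⟨Pi.single 0 1, by simp, ?_⟩⟩
    rw [qf_single]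
    simp
  | succ n ih =>
    exact (herm_step (n := n) (by simp) ih).transfer (Fintype.equivOfCardEq (by simp; omega))

theorem bdd_aniso (hH : Herm (Unit ⊕ κ)) (h : Bdd κ) (D : ℤ) :
    ∃ K : ℤ, ∀ A : Matrix (Unit ⊕ κ) (Unit ⊕ κ) ℤ, A.IsSymm → A.det ≠ 0 → |A.det| ≤ D →
    Aniso A → ∃ B, Eqv A B ∧ ∀ i j, |B i j| ≤ K := by
  obtain ⟨C, hC, hH⟩ := hH
  set M := C * D with hM
  obtain ⟨K, hK⟩ := h (M ^ Fintype.card κ * D)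
  refine ⟨M + (|K| + M ^ 2), fun A₀ hA₀ hd₀ hD₀ han₀ => ?_⟩
  obtain ⟨x, hx, hb⟩ := hH A₀ hA₀ han₀
  obtain ⟨A₁, hE₁, d, hd, hq⟩ := minval (.inl ()) A₀ x hx
  have hA₁ := hE₁.symm_mat hA₀
  have ha0 : A₁ (.inl ()) (.inl ()) ≠ 0 := (hE₁.aniso han₀).corner _
  set a := A₁ (.inl ()) (.inl ()) with ha
  have hapos : 0 < |a| := abs_pos.2 ha0
  have haM : |a| ≤ M := by
    have h1 : |a| ≤ |qf A₀ x| := by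
      rw [hq, abs_mul]
      have h3 : 1 ≤ |d ^ 2| := Int.one_le_abs (pow_ne_zero 2 hd)
      nlinarith
    have h2 : |qf A₀ x| ≤ |qf A₀ x| ^ Fintype.card (Unit ⊕ κ) :=
      le_self_pow₀ (by omega) (by simp)
    exact h1.trans (h2.trans (hb.trans (mul_le_mul_of_nonneg_left hD₀ hC)))
  have hM0 : 0 ≤ M := hapos.le.trans haM
  have hdet := Gm_det A₁
  rw [hE₁.det_eq, ← ha] at hdet
  have hG0 : (Gm A₁).det ≠ 0 := by
    intro h0
    rw [h0, mul_zero] at hdet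
    exact mul_ne_zero (pow_ne_zero _ ha0) hd₀ hdet
  have hGb : |(Gm A₁).det| ≤ M ^ Fintype.card κ * D := by
    have h1 := congrArg abs hdet
    rw [abs_mul, abs_mul, abs_pow] at h1
    have h2 : |(Gm A₁).det| ≤ |a| * |(Gm A₁).det| := by nlinarith [abs_nonneg (Gm A₁).det]
    rw [← h1] at h2
    exact h2.trans (by gcongr)
  obtain ⟨_, ⟨Q, hQ, rfl⟩, hGK⟩ := hK (Gm A₁) (Gm_symm hA₁) hG0 hGb
  obtain ⟨A₂, hE₂, h00, -, -, hG₂⟩ := stepQ A₁ Q hQ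
  rw [← hG₂] at hGK
  have hA₂ := hE₂.symm_mat hA₁
  choose k hk using fun j => near (A₂ (.inl ()) (.inr j)) a
  obtain ⟨A₃, hE₃, h00', h01, -, hG₃⟩ := stepK hA₂ k
  rw [← hG₃] at hGK
  have hA₃ := hE₃.symm_mat hA₂
  refine ⟨A₃, (hE₁.trans hE₂).trans hE₃, ?_⟩
  rw [h00, ← ha] at h00' h01
  have hbd : ∀ j, |A₃ (.inl ()) (.inr j)| ≤ M := by
    intro j
    rw [h01]
    have := (hk j).resolve_right ha0
    have h' := abs_nonneg (A₂ (.inl ()) (.inr j) + a * k j)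
    linarith
  have hK0 := abs_nonneg K
  have hM2 := sq_nonneg M
  rintro (⟨⟩ | i) (⟨⟩ | j)
  · rw [h00']; linarith
  · linarith [hbd j]
  · rw [hA₃.apply]; linarith [hbd i]
  · have h1 := hGK i j
    simp only [Gm, of_apply, h00'] at h1
    rw [hA₃.apply (.inl ()) (.inr i)] at h1
    have h2 : |a * A₃ (.inr i) (.inr j)| ≤ |K| + M ^ 2 := by
      have h3 : |A₃ (.inl ()) (.inr i) * A₃ (.inl ()) (.inr j)| ≤ M ^ 2 := by
        rw [abs_mul, sq]
        exact mul_le_mul (hbd i) (hbd j) (abs_nonneg _) hM0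
      have h4 := abs_sub_abs_le_abs_sub (a * A₃ (.inr i) (.inr j))
        (A₃ (.inl ()) (.inr i) * A₃ (.inl ()) (.inr j))
      linarith [le_abs_self K]
    rw [abs_mul] at h2
    have h5 : |A₃ (.inr i) (.inr j)| ≤ |a| * |A₃ (.inr i) (.inr j)| := by
      nlinarith [abs_nonneg (A₃ (.inr i) (.inr j))]
    linarith

theorem det_iso {A : Matrix (Unit ⊕ (Unit ⊕ κ)) (Unit ⊕ (Unit ⊕ κ)) ℤ} (hA : A.IsSymm) (m : ℤ)
    (h00 : A (.inl ()) (.inl ()) = 0)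
    (h0 : ∀ j, A (.inl ()) (.inr j) = (Pi.single (.inl ()) m : Unit ⊕ κ → ℤ) j) :
    |A.det| = m ^ 2 * |A.toBlocks₂₂.toBlocks₂₂.det| := by
  have h1 := det_permute (Equiv.swap (.inl ()) (.inr (.inl ())) : Equiv.Perm (Unit ⊕ (Unit ⊕ κ))) A
  have hs : ∀ i, A (.inr i) (.inl ()) = (Pi.single (.inl ()) m : Unit ⊕ κ → ℤ) i :=
    fun i => (hA.apply _ _).trans (h0 i)
  have h2 : A.submatrix (Equiv.swap (.inl ()) (.inr (.inl ())) : Equiv.Perm (Unit ⊕ (Unit ⊕ κ))) id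
     = fromBlocks (Matrix.of fun _ _ => m) (Matrix.of fun _ j => A (.inr (.inl ())) (.inr j)) 0
      (fromBlocks (Matrix.of fun _ _ => m) 0
        (Matrix.of fun i _ => A (.inr (.inr i)) (.inr (.inl ()))) A.toBlocks₂₂.toBlocks₂₂) := by
    ext i j
    rcases i with ⟨⟩ | ⟨⟩ | i <;> rcases j with ⟨⟩ | ⟨⟩ | j <;>
      simp [h00, h0, hs, toBlocks₂₂, Equiv.swap_apply_of_ne_of_ne]
  rw [h2, det_fromBlocks_zero₂₁, det_fromBlocks_zero₁₂] at h1
  have h3 := congrArg abs h1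
  rw [abs_mul (_ : ℤ) A.det] at h3
  have h4 : ∀ u : ℤˣ, |(((u : ℤ) : ℤ))| = 1 := fun u => by
    rcases Int.units_eq_one_or u with rfl | rfl <;> simp
  erw [h4] at h3
  rw [one_mul] at h3
  rw [← h3]
  simp [abs_mul, ← mul_assoc, ← sq]

theorem bdd_iso (h : Bdd κ) (D : ℤ) :
    ∃ K : ℤ, ∀ A : Matrix (Unit ⊕ (Unit ⊕ κ)) (Unit ⊕ (Unit ⊕ κ)) ℤ, A.IsSymm → A.det ≠ 0 →
    |A.det| ≤ D → ¬ Aniso A → ∃ B, Eqv A B ∧ ∀ i j, |B i j| ≤ K := by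
  obtain ⟨K, hK⟩ := h D
  refine ⟨2 * D + |K|, fun A₀ hA₀ hd₀ hD₀ han₀ => ?_⟩
  obtain ⟨x, hqx, hx⟩ : ∃ x, qf A₀ x = 0 ∧ x ≠ 0 := by
    unfold Aniso at han₀; push Not at han₀; exact han₀
  obtain ⟨A₁, hE₁, d, hd, hq⟩ := minval (.inl ()) A₀ x hx
  have hA₁ := hE₁.symm_mat hA₀
  have h00₁ : A₁ (.inl ()) (.inl ()) = 0 := by
    rw [hqx] at hq
    exact (mul_eq_zero.1 hq.symm).resolve_left (pow_ne_zero 2 hd)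
  obtain ⟨P, hP, m, hm⟩ := euclid (.inl () : Unit ⊕ κ) (fun i => A₁ (.inl ()) (.inr i))
  obtain ⟨A₂, hE₂, h00₂, h01₂, -, -⟩ := stepQ A₁ Pᵀ (by rwa [det_transpose])
  rw [vecMul_transpose, hm] at h01₂
  rw [h00₁] at h00₂
  have hA₂ := hE₂.symm_mat hA₁
  have hdet := det_iso hA₂ m h00₂ h01₂
  rw [hE₂.det_eq, hE₁.det_eq] at hdet
  have hm0 : m ≠ 0 := by
    rintro rfl
    simp at hdet
    exact hd₀ hdet
  have hG0 : A₂.toBlocks₂₂.toBlocks₂₂.det ≠ 0 := by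
    intro h0
    rw [h0] at hdet
    simp at hdet
    exact hd₀ hdet
  have hg1 := Int.one_le_abs hG0
  have hm1 := Int.one_le_abs hm0
  rw [← sq_abs] at hdet
  have hm2 : |m| ≤ |m| ^ 2 := by nlinarith
  have hGD : |A₂.toBlocks₂₂.toBlocks₂₂.det| ≤ D := by
    refine le_trans ?_ (hdet ▸ hD₀)
    exact le_mul_of_one_le_left (abs_nonneg _) (hm1.trans hm2)
  have hmD : |m| ≤ D := by
    refine le_trans ?_ (hdet ▸ hD₀)
    exact hm2.trans (le_mul_of_one_le_right (sq_nonneg _) hg1)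
  obtain ⟨_, ⟨Q, hQ, rfl⟩, hGK⟩ := hK A₂.toBlocks₂₂.toBlocks₂₂
    (by ext i j; exact hA₂.apply _ _) hG0 hGD
  obtain ⟨A₃, hE₃, h00₃, h01₃, h11₃, -⟩ := stepQ A₂ (fromBlocks 1 0 0 Q)
    (by rw [det_fromBlocks_zero₂₁]; simpa using hQ)
  have hA₃ := hE₃.symm_mat hA₂
  rw [h00₂] at h00₃
  replace h01₃ : ∀ j, A₃ (.inl ()) (.inr j) = (Pi.single (.inl ()) m : Unit ⊕ κ → ℤ) j := by
    intro j
    rw [h01₃, funext h01₂, single_vecMul]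
    rcases j with j | j <;> simp
  have hGK₃ : ∀ i j, |A₃ (.inr (.inr i)) (.inr (.inr j))| ≤ K := by
    intro i j
    have h1 : A₃.toBlocks₂₂.toBlocks₂₂ = Qᵀ * A₂.toBlocks₂₂.toBlocks₂₂ * Q := by
      rw [h11₃]
      conv_lhs => rw [← fromBlocks_toBlocks A₂.toBlocks₂₂]
      simp [fromBlocks_transpose, fromBlocks_multiply]
    have h2 := hGK i j
    rw [← h1] at h2
    exact h2
  choose k hk using fun j => near (A₃ (.inr (.inl ())) (.inr (.inr j))) m
  obtain ⟨k0, hk0⟩ := near (A₃ (.inr (.inl ())) (.inr (.inl ()))) (2 * m)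
  obtain ⟨A₄, hE₄, h00₄, h01₄, h11₄, -⟩ := stepK hA₃ (Sum.elim (fun _ => k0) k)
  have hA₄ := hE₄.symm_mat hA₃
  refine ⟨A₄, ((hE₁.trans hE₂).trans hE₃).trans hE₄, ?_⟩
  have hK0 := abs_nonneg K
  have hKK := le_abs_self K
  have hwb : ∀ j, |A₄ (.inr (.inl ())) (.inr (.inr j))| ≤ D := by
    intro j
    have h1 := (hk j).resolve_right hm0
    have h2 := abs_nonneg (A₃ (.inr (.inl ())) (.inr (.inr j)) + m * k j)
    have h3 : A₄ (.inr (.inl ())) (.inr (.inr j)) =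
      A₃ (.inr (.inl ())) (.inr (.inr j)) + m * k j := by
      rw [h11₄]; simp [h01₃, h00₃]
    rw [h3]; linarith
  have hb0 : ∀ j, |A₄ (.inl ()) (.inr j)| ≤ D := by
    intro j
    rw [h01₄, h01₃, h00₃]
    rcases j with j | j
    · simpa using hmD
    · simp; linarith
  rintro (⟨⟩ | i) (⟨⟩ | j)
  · rw [h00₄, h00₃]; simp; linarith
  · linarith [hb0 j]
  · rw [hA₄.apply]; linarith [hb0 i]
  · rcases i with ⟨⟩ | i <;> rcases j with ⟨⟩ | j
    · have h1 := hk0.resolve_right (by simpa using hm0)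
      rw [abs_mul] at h1
      have h3 : A₄ (.inr (.inl ())) (.inr (.inl ())) =
        A₃ (.inr (.inl ())) (.inr (.inl ())) + 2 * m * k0 := by
        rw [h11₄]; simp [h01₃, h00₃]; ring
      rw [h3]
      simp at h1
      linarith
    · linarith [hwb j]
    · rw [hA₄.apply]; linarith [hwb i]
    · have h3 : A₄ (.inr (.inr i)) (.inr (.inr j)) = A₃ (.inr (.inr i)) (.inr (.inr j)) := by
        rw [h11₄]; simp [h01₃, h00₃]
      rw [h3]; linarith [hGK₃ i j]

theorem aniso_transfer (e : ι ≃ κ) (A : Matrix κ κ ℤ) (h : Aniso (A.submatrix e e)) : Aniso A := by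
  intro x hx
  rw [← qf_submatrix e] at hx
  have := h _ hx
  ext i
  simpa using congrFun this (e.symm i)

theorem bdd_fin (n : ℕ) : Bdd (Fin n) := by
  induction n using Nat.strong_induction_on with
  | _ n ih =>
  match n, ih with
  | 0, _ => exact fun D => ⟨0, fun A _ _ _ => ⟨A, Eqv.refl A, fun i => i.elim0⟩⟩
  | 1, ih =>
    refine fun D => ⟨D, fun A _ _ hD => ⟨A, Eqv.refl A, fun i j => ?_⟩⟩
    rw [det_fin_one] at hD
    rwa [Subsingleton.elim i 0, Subsingleton.elim j 0]
  | n + 2, ih =>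
    have hB : Bdd (Unit ⊕ (Unit ⊕ Fin n)) := by
      intro D
      have hH : Herm (Unit ⊕ (Unit ⊕ Fin n)) :=
        (herm_fin (n + 1)).transfer (Fintype.equivOfCardEq (by simp; omega))
      have h1 : Bdd (Unit ⊕ Fin n) :=
        (ih (n + 1) (by omega)).transfer (Fintype.equivOfCardEq (by simp; omega))
      obtain ⟨K₁, h₁⟩ := bdd_aniso hH h1 D
      obtain ⟨K₂, h₂⟩ := bdd_iso (ih n (by omega)) D
      refine ⟨max K₁ K₂, fun A hA hd hD => ?_⟩
      by_cases han : Aniso A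
      · obtain ⟨B, hE, hB⟩ := h₁ A hA hd hD han
        exact ⟨B, hE, fun i j => (hB i j).trans (le_max_left _ _)⟩
      · obtain ⟨B, hE, hB⟩ := h₂ A hA hd hD han
        exact ⟨B, hE, fun i j => (hB i j).trans (le_max_right _ _)⟩
    exact hB.transfer (Fintype.equivOfCardEq (by simp; omega))

end LatFin

theorem stmt_12 (r D : ℕ) (hr : 0 < r) (hD : 0 < D) :
    ∃ s : Finset (Matrix (Fin r) (Fin r) ℤ),
      ∀ A : Matrix (Fin r) (Fin r) ℤ, A.IsSymm → A.det.natAbs = D →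
        ∃ B ∈ s, ∃ P : Matrix (Fin r) (Fin r) ℤ, IsUnit P.det ∧
          P.transpose * A * P = B := by
  obtain ⟨K, hK⟩ := LatFin.bdd_fin r D
  refine ⟨(Fintype.piFinset fun _ : Fin r => Fintype.piFinset fun _ : Fin r =>
    Finset.Icc (-K) K : Finset (Fin r → Fin r → ℤ)), fun A hA hd => ?_⟩
  obtain ⟨B, ⟨P, hP, hPB⟩, hB⟩ := hK A hA (by omega) (by rw [Int.abs_eq_natAbs, hd])
  refine ⟨B, ?_, P, hP, hPB⟩
  refine Fintype.mem_piFinset.2 fun i => Fintype.mem_piFinset.2 fun j => ?_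
  exact Finset.mem_Icc.2 (abs_le.1 (hB i j))
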